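/- For every real α with 0 < α < 1, the quantity [2 − 2cos(πα)/cos(πα/2) + α·tan(πα/2)] − 2sin²(πα/2) is strictly positive. -/

import Mathlib

open Real

theorem trig_positivity (α : ℝ) (hα0 : 0 < α) (hα1 : α < 1) :
    0 < (2 - 2 * Real.cos (π * α) / Real.cos (π * α / 2) + α * Real.tan (π * α / 2))
        - 2 * (Real.sin (π * α / 2)) ^ 2 := by
  have hx0 : 0 < π * α / 2 := by positivity
  have hx1 : π * α / 2 < π / 2 := by nlinarith [pi_pos]
  have hdouble : cos (π * α) = 2 * cos (π * α / 2) ^ 2 - 1 := by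
    rw [← cos_two_mul]
    ring_nf
  rw [hdouble, tan_eq_sin_div_cos, sin_sq]
  have hc : 0 < cos (π * α / 2) := cos_pos_of_mem_Ioo ⟨by linarith, hx1⟩
  have hs : 0 < sin (π * α / 2) := sin_pos_of_pos_of_lt_pi hx0 (by linarith)
  have hc1 : cos (π * α / 2) ≤ 1 := cos_le_one _
  generalize cos (π * α / 2) = c at *
  generalize sin (π * α / 2) = s at *
  have hfactor : 2 - 2 * (2 * c ^ 2 - 1) / c + α * (s / c) - 2 * (1 - c ^ 2)
      = (2 * (1 - c) * (1 + c * (1 - c)) + α * s) / c := by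
    field_simp
    ring
  rw [hfactor]
  have hd : 0 ≤ 1 - c := sub_nonneg.mpr hc1
  positivity
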